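/- Suppose the high temperature condition holds with parameters q ∈ [0,1) and K > 0. Define ℓ̇₁ := (1/√N) Σ_{j=2}^N g_{1j} σ̇_j and η₁ := 1 + β ℓ̇₁ σ₁ - β²(1-q) σ̇₁ σ₁. Then there exists a constant C depending only on β, h, K such that E( ⟨η₁⟩ - 1 )² ≤ C / √N. -/

import Mathlib

open MeasureTheory ProbabilityTheory Real Finset

namespace SK

/-- Index set of pairs `i < j` in `Fin N`. -/
abbrev Pairs (N : ℕ) := {p : Fin N × Fin N // p.1 < p.2}

/-- The disorder: one real coordinate per pair. -/
abbrev Disorder (N : ℕ) := Pairs N → ℝ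

/-- Law of the disorder: i.i.d. standard Gaussians. -/
noncomputable def μdis (N : ℕ) : Measure (Disorder N) :=
  Measure.pi fun _ => gaussianReal 0 1

/-- The symmetric extension `g_{ij}` of the disorder. -/
noncomputable def gval {N : ℕ} (G : Disorder N) (i j : Fin N) : ℝ :=
  if hij : i < j then G ⟨(i, j), hij⟩ else if hji : j < i then G ⟨(j, i), hji⟩ else 0

abbrev Config (N : ℕ) := Fin N → Bool

/-- Spins `±1`. -/
def spin (b : Bool) : ℝ := if b then 1 else -1

/-- (Negative) Hamiltonian of the SK model. -/
noncomputable def ham {N : ℕ} (β h : ℝ) (G : Disorder N) (σ : Config N) : ℝ :=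
  (β / Real.sqrt N) * ∑ p : Pairs N, G p * spin (σ p.1.1) * spin (σ p.1.2)
    + h * ∑ i, spin (σ i)

/-- Partition function. -/
noncomputable def Zpart {N : ℕ} (β h : ℝ) (G : Disorder N) : ℝ :=
  ∑ σ : Config N, Real.exp (ham β h G σ)

/-- Gibbs measure. -/
noncomputable def gibbs {N : ℕ} (β h : ℝ) (G : Disorder N) (σ : Config N) : ℝ :=
  Real.exp (ham β h G σ) / Zpart β h G

/-- Quenched average of a function of one replica. -/
noncomputable def qavg {N : ℕ} (β h : ℝ) (G : Disorder N) (f : Config N → ℝ) : ℝ :=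
  ∑ σ : Config N, f σ * gibbs β h G σ

/-- Quenched average of a function of two replicas. -/
noncomputable def qavg2 {N : ℕ} (β h : ℝ) (G : Disorder N)
    (f : Config N → Config N → ℝ) : ℝ :=
  ∑ σ1 : Config N, ∑ σ2 : Config N, f σ1 σ2 * gibbs β h G σ1 * gibbs β h G σ2

/-- Overlap of two configurations. -/
noncomputable def overlap {N : ℕ} (σ1 σ2 : Config N) : ℝ :=
  (1 / (N : ℝ)) * ∑ i, spin (σ1 i) * spin (σ2 i)

/-- The high temperature condition `E⟨(R₁₂ - q)⁴⟩ ≤ K/N²`. -/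
def highTemp (N : ℕ) (β h q K : ℝ) : Prop :=
  ∫ G, qavg2 β h G (fun σ1 σ2 => (overlap σ1 σ2 - q) ^ 4) ∂(μdis N) ≤ K / (N : ℝ) ^ 2

/-- Magnetization `⟨σ_i⟩`. -/
noncomputable def mavg {N : ℕ} (β h : ℝ) (G : Disorder N) (i : Fin N) : ℝ :=
  qavg β h G fun σ => spin (σ i)

/-- Local field `ℓ_i`. -/
noncomputable def locField {N : ℕ} (G : Disorder N) (i : Fin N) (σ : Config N) : ℝ :=
  (1 / Real.sqrt N) * ∑ j ∈ Finset.univ.erase i, gval G i j * spin (σ j)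

/-- The field `r_i`. -/
noncomputable def rfield {N : ℕ} (β h q : ℝ) (G : Disorder N) (i : Fin N) : ℝ :=
  (1 / Real.sqrt N) * ∑ j ∈ Finset.univ.erase i, gval G i j * mavg β h G j
    - β * (1 - q) * mavg β h G i

/-- Gaussian density `φ_{μ,v}` with mean `μ` and variance `v`. -/
noncomputable def gaussDens (μ v x : ℝ) : ℝ :=
  (1 / (Real.sqrt (2 * π) * Real.sqrt v)) * Real.exp (-(x - μ) ^ 2 / (2 * v))

/-- Mixture-Gaussian density `ψ_{a,b,μ,v}`. -/
noncomputable def mixDens (a b μ v x : ℝ) : ℝ :=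
  Real.cosh (a * x + b) * Real.exp (-(x - μ) ^ 2 / (2 * v)) /
    (Real.sqrt (2 * π) * Real.sqrt v * Real.cosh (a * μ + b) * Real.exp (a ^ 2 * v / 2))


theorem integral_id_mul_gaussianReal {f f' : ℝ → ℝ} (hf : ∀ x, HasDerivAt f (f' x) x)
    (h0 : Integrable f (gaussianReal 0 1)) (h1 : Integrable f' (gaussianReal 0 1))
    (h2 : Integrable (fun x => x * f x) (gaussianReal 0 1)) :
    ∫ x, x * f x ∂gaussianReal 0 1 = ∫ x, f' x ∂gaussianReal 0 1 := by
  have key : ∀ g : ℝ → ℝ, Integrable g (gaussianReal 0 1) →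
      Integrable (fun x => g x * gaussianPDFReal 0 1 x) := by
    intro g hg
    rw [gaussianReal_of_var_ne_zero _ one_ne_zero, integrable_withDensity_iff
      (measurable_gaussianPDF 0 1) (Filter.Eventually.of_forall fun x => by
        simp [gaussianPDF])] at hg
    simpa [toReal_gaussianPDF] using hg
  have hd : ∀ x, HasDerivAt (gaussianPDFReal 0 1) (-x * gaussianPDFReal 0 1 x) x := by
    intro x
    have : HasDerivAt (fun x : ℝ => -(x - 0) ^ 2 / (2 * ((1 : NNReal) : ℝ))) (-x) x := by
      have := (((hasDerivAt_id x).sub_const 0).pow 2).neg.div_const (2 * ((1 : NNReal) : ℝ))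
      refine this.congr_deriv ?_
      simp
      ring
    have := this.exp.const_mul ((√(2 * π * ((1 : NNReal) : ℝ)))⁻¹)
    refine this.congr_deriv ?_
    simp only [gaussianPDFReal]
    ring
  have h := integral_mul_deriv_eq_deriv_mul_of_integrable (u := f) (u' := f')
    (v := gaussianPDFReal 0 1) (v' := fun x => -x * gaussianPDFReal 0 1 x)
    (fun x _ => hf x) (fun x _ => hd x)
    ((key _ h2).neg.congr (Filter.Eventually.of_forall fun x => by simp; ring))
    (key _ h1) (key _ h0)
  simp only [integral_gaussianReal_eq_integral_smul one_ne_zero, smul_eq_mul]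
  have e : ∀ x, gaussianPDFReal 0 1 x * (x * f x) = -(f x * (-x * gaussianPDFReal 0 1 x)) :=
    fun x => by ring
  simp only [e, integral_neg, h, neg_neg]
  exact integral_congr_ae (Filter.Eventually.of_forall fun x => mul_comm _ _)

theorem measurePreserving_update_pi {ι : Type*} [Fintype ι] [DecidableEq ι]
    (ν : ι → Measure ℝ) [∀ i, IsProbabilityMeasure (ν i)] (i : ι) :
    MeasurePreserving (fun x : (ι → ℝ) × ℝ => Function.update x.1 i x.2)
      ((Measure.pi ν).prod (ν i)) (Measure.pi ν) := by
  have hm : Measurable (fun x : (ι → ℝ) × ℝ => Function.update x.1 i x.2) :=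
    measurable_update'
  refine ⟨hm, (Measure.pi_eq fun s hs => ?_).symm⟩
  rw [Measure.map_apply hm (MeasurableSet.univ_pi hs)]
  have : (fun x : (ι → ℝ) × ℝ => Function.update x.1 i x.2) ⁻¹' Set.univ.pi s
      = (Set.univ.pi (Function.update s i Set.univ)) ×ˢ s i := by
    ext ⟨x, y⟩
    simp only [Set.mem_preimage, Set.mem_pi, Set.mem_univ, true_imp_iff, Set.mem_prod]
    constructor
    · intro h
      refine ⟨fun j => ?_, by simpa using h i⟩
      by_cases hj : j = i
      · subst hj; simp
      · simpa [hj] using h j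
    · rintro ⟨h, hy⟩ j
      by_cases hj : j = i
      · subst hj; simpa
      · simpa [hj] using h j
  rw [this, Measure.prod_prod, Measure.pi_pi, ← Finset.prod_erase_mul _ _ (Finset.mem_univ i),
    ← Finset.prod_erase_mul (a := i) _ (fun i => ν i (s i)) (Finset.mem_univ i)]
  simp only [Function.update_self, measure_univ, mul_one]
  congr 1
  exact Finset.prod_congr rfl fun j hj => by
    rw [Function.update_of_ne (Finset.ne_of_mem_erase hj)]

/-- Partial derivative in the `i`-th coordinate. -/
noncomputable def partialDeriv {ι : Type*} [Fintype ι] [DecidableEq ι] (i : ι)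
    (F : (ι → ℝ) → ℝ) (x : ι → ℝ) : ℝ :=
  fderiv ℝ F x (Pi.single i 1)

section
variable {ι : Type*} [Fintype ι] [DecidableEq ι]

theorem partialDeriv_mul {F H : (ι → ℝ) → ℝ} (hF : Differentiable ℝ F)
    (hH : Differentiable ℝ H) (i : ι) :
    partialDeriv i (fun x => F x * H x)
      = fun x => partialDeriv i F x * H x + F x * partialDeriv i H x := by
  funext x
  simp only [partialDeriv]
  rw [fderiv_fun_mul (hF x) (hH x)]
  simp
  ring

theorem partialDeriv_add {F H : (ι → ℝ) → ℝ} (hF : Differentiable ℝ F)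
    (hH : Differentiable ℝ H) (i : ι) :
    partialDeriv i (fun x => F x + H x)
      = fun x => partialDeriv i F x + partialDeriv i H x := by
  funext x
  simp only [partialDeriv]
  rw [fderiv_fun_add (hF x) (hH x)]
  simp

theorem partialDeriv_sub {F H : (ι → ℝ) → ℝ} (hF : Differentiable ℝ F)
    (hH : Differentiable ℝ H) (i : ι) :
    partialDeriv i (fun x => F x - H x)
      = fun x => partialDeriv i F x - partialDeriv i H x := by
  funext x
  simp only [partialDeriv]
  rw [fderiv_fun_sub (hF x) (hH x)]
  simp

theorem partialDeriv_coord (i j : ι) :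
    partialDeriv i (fun x : ι → ℝ => x j) = fun _ => if i = j then 1 else 0 := by
  funext x
  simp only [partialDeriv]
  rw [(hasFDerivAt_apply j x).fderiv]
  simp [Pi.single_apply, eq_comm]

theorem partialDeriv_const (i : ι) (a : ℝ) :
    partialDeriv i (fun _ : ι → ℝ => a) = fun _ => 0 := by
  funext x
  simp [partialDeriv]

theorem partialDeriv_comm {F : (ι → ℝ) → ℝ} (hF : ContDiff ℝ 2 F) (i j : ι) :
    partialDeriv i (partialDeriv j F) = partialDeriv j (partialDeriv i F) := by
  have hd : Differentiable ℝ (fderiv ℝ F) :=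
    (hF.fderiv_right (m := 1) (by norm_num)).differentiable (by norm_num)
  have h : ∀ (i j : ι) (x : ι → ℝ), partialDeriv i (partialDeriv j F) x
      = fderiv ℝ (fderiv ℝ F) x (Pi.single i 1) (Pi.single j 1) := by
    intro i j x
    change fderiv ℝ (fun y => fderiv ℝ F y (Pi.single j 1)) x (Pi.single i 1) = _
    rw [fderiv_clm_apply (hd x) (differentiableAt_const _)]
    simp
  funext x
  rw [h, h]
  exact (hF.contDiffAt.isSymmSndFDerivAt (by simp)) _ _

theorem hasDerivAt_comp_update {F : (ι → ℝ) → ℝ} (hF : Differentiable ℝ F) (i : ι) (x : ι → ℝ)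
    (y : ℝ) : HasDerivAt (fun y => F (Function.update x i y))
      (partialDeriv i F (Function.update x i y)) y :=
  (hF _).hasFDerivAt.comp_hasDerivAt y (hasDerivAt_update x i y)

/-- Gaussian integration by parts in one coordinate. -/
theorem integral_coord_mul_pi_gaussianReal {F : (ι → ℝ) → ℝ} (hF : Differentiable ℝ F) (i : ι)
    (h0 : Integrable F (Measure.pi fun _ : ι => gaussianReal 0 1))
    (h1 : Integrable (partialDeriv i F) (Measure.pi fun _ : ι => gaussianReal 0 1))
    (h2 : Integrable (fun x => x i * F x) (Measure.pi fun _ : ι => gaussianReal 0 1)) :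
    ∫ x, x i * F x ∂(Measure.pi fun _ : ι => gaussianReal 0 1)
      = ∫ x, partialDeriv i F x ∂(Measure.pi fun _ : ι => gaussianReal 0 1) := by
  have hp := measurePreserving_update_pi (fun _ : ι => gaussianReal 0 1) i
  have hint : ∀ g : (ι → ℝ) → ℝ, Integrable g (Measure.pi fun _ : ι => gaussianReal 0 1) →
      ∫ x, g x ∂(Measure.pi fun _ : ι => gaussianReal 0 1)
        = ∫ x, ∫ y, g (Function.update x i y) ∂gaussianReal 0 1
            ∂(Measure.pi fun _ : ι => gaussianReal 0 1) := by
    intro g hg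
    have hg' := hp.integrable_comp_of_integrable hg
    refine Eq.trans ?_ (integral_prod _ hg')
    conv_lhs => rw [← hp.map_eq]
    exact integral_map hp.measurable.aemeasurable (by rw [hp.map_eq]; exact hg.1)
  rw [hint _ h2, hint _ h1]
  refine integral_congr_ae ?_
  filter_upwards [(hp.integrable_comp_of_integrable h0).prod_right_ae,
    (hp.integrable_comp_of_integrable h1).prod_right_ae,
    (hp.integrable_comp_of_integrable h2).prod_right_ae] with x a0 a1 a2
  simp only [Function.comp_def, Function.update_self] at a0 a1 a2 ⊢
  exact integral_id_mul_gaussianReal (fun y => hasDerivAt_comp_update hF i x y) a0 a1 a2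

end

theorem partialDeriv_fun_sum {ι κ : Type*} [Fintype ι] [DecidableEq ι] (s : Finset κ)
    {F : κ → (ι → ℝ) → ℝ} (hF : ∀ k ∈ s, Differentiable ℝ (F k)) (i : ι) :
    partialDeriv i (fun x => ∑ k ∈ s, F k x) = fun x => ∑ k ∈ s, partialDeriv i (F k) x := by
  funext x
  simp only [partialDeriv]
  rw [fderiv_fun_sum fun k hk => hF k hk x]
  simp

theorem partialDeriv_eq_of_hasDerivAt_line {ι : Type*} [Fintype ι] [DecidableEq ι]
    {F : (ι → ℝ) → ℝ} {x : ι → ℝ} (hF : DifferentiableAt ℝ F x) {i : ι} {d : ℝ}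
    (h : HasDerivAt (fun t : ℝ => F (x + t • Pi.single i 1)) d 0) : partialDeriv i F x = d := by
  rw [partialDeriv, ← hF.lineDeriv_eq_fderiv]
  exact h.deriv

section
variable {N : ℕ} (β h : ℝ)

/-- The product of the two spins attached to a pair of sites. -/
noncomputable def pairSpin (p : Pairs N) (σ : Config N) : ℝ :=
  spin (σ p.1.1) * spin (σ p.1.2)

theorem ham_add_single (G : Disorder N) (p : Pairs N) (t : ℝ) (σ : Config N) :
    ham β h (G + t • Pi.single p 1) σ
      = ham β h G σ + t * ((β / Real.sqrt N) * pairSpin p σ) := by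
  simp only [ham, pairSpin, Pi.add_apply, Pi.smul_apply, smul_eq_mul, add_mul,
    Finset.sum_add_distrib, Pi.single_apply, mul_ite, mul_one, mul_zero, ite_mul, zero_mul,
    Finset.sum_ite_eq', Finset.mem_univ, if_true]
  ring

theorem contDiff_ham (σ : Config N) : ContDiff ℝ ⊤ (fun G : Disorder N => ham β h G σ) := by
  unfold ham
  fun_prop

theorem Zpart_pos (G : Disorder N) : 0 < Zpart β h G :=
  Finset.sum_pos (fun _ _ => Real.exp_pos _) Finset.univ_nonempty

theorem contDiff_gibbs (σ : Config N) :
    ContDiff ℝ ⊤ (fun G : Disorder N => gibbs β h G σ) := by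
  unfold gibbs
  refine ContDiff.div (contDiff_ham β h σ).exp ?_ fun G => (Zpart_pos β h G).ne'
  unfold Zpart
  exact ContDiff.sum fun τ _ => (contDiff_ham β h τ).exp

theorem gibbs_nonneg (G : Disorder N) (σ : Config N) : 0 ≤ gibbs β h G σ :=
  div_nonneg (Real.exp_pos _).le (Zpart_pos β h G).le

theorem sum_gibbs (G : Disorder N) : ∑ σ, gibbs β h G σ = 1 := by
  simp only [gibbs]
  rw [← Finset.sum_div]
  exact div_self (Zpart_pos β h G).ne'

theorem gibbs_le_one (G : Disorder N) (σ : Config N) : gibbs β h G σ ≤ 1 := by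
  rw [← sum_gibbs β h G]
  exact Finset.single_le_sum (fun τ _ => gibbs_nonneg β h G τ) (Finset.mem_univ σ)

theorem partialDeriv_gibbs (p : Pairs N) (σ : Config N) :
    partialDeriv p (fun G => gibbs β h G σ) = fun G => (β / Real.sqrt N) *
      (pairSpin p σ * gibbs β h G σ - gibbs β h G σ * qavg β h G (pairSpin p)) := by
  funext G
  apply partialDeriv_eq_of_hasDerivAt_line
    ((contDiff_gibbs β h σ).differentiable (by simp) G)
  have hexp : ∀ τ, HasDerivAt (fun t : ℝ => Real.exp (ham β h (G + t • Pi.single p 1) τ))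
      (Real.exp (ham β h G τ) * ((β / Real.sqrt N) * pairSpin p τ)) 0 := by
    intro τ
    simp only [ham_add_single]
    have := (((hasDerivAt_id (0 : ℝ)).mul_const
      ((β / Real.sqrt N) * pairSpin p τ)).const_add (ham β h G τ)).exp
    simpa using this
  have hZ : HasDerivAt (fun t : ℝ => Zpart β h (G + t • Pi.single p 1))
      (∑ τ, Real.exp (ham β h G τ) * ((β / Real.sqrt N) * pairSpin p τ)) 0 :=
    HasDerivAt.fun_sum fun τ _ => hexp τ
  have hne := (Zpart_pos β h G).ne'
  have := (hexp σ).fun_div hZ (by simpa using hne)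
  refine this.congr_deriv ?_
  have e : qavg β h G (pairSpin p)
      = (∑ τ, Real.exp (ham β h G τ) * pairSpin p τ) / Zpart β h G := by
    simp only [qavg, gibbs, Finset.sum_div]
    exact Finset.sum_congr rfl fun τ _ => by ring
  have e' : ∑ τ, Real.exp (ham β h G τ) * ((β / Real.sqrt N) * pairSpin p τ)
      = (β / Real.sqrt N) * ∑ τ, Real.exp (ham β h G τ) * pairSpin p τ := by
    rw [Finset.mul_sum]
    exact Finset.sum_congr rfl fun τ _ => by ring
  rw [e, e', gibbs]
  simp only [zero_smul, add_zero]
  field_simp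

theorem partialDeriv_qavg (p : Pairs N) (f : Config N → ℝ) :
    partialDeriv p (fun G => qavg β h G f) = fun G => (β / Real.sqrt N) *
      (qavg β h G (fun σ => f σ * pairSpin p σ)
        - qavg β h G f * qavg β h G (pairSpin p)) := by
  have hd : ∀ σ, Differentiable ℝ (fun G : Disorder N => gibbs β h G σ) := fun σ =>
    (contDiff_gibbs β h σ).differentiable (by simp)
  have : (fun G : Disorder N => qavg β h G f) = fun G => ∑ σ, f σ * gibbs β h G σ := rfl
  rw [this, partialDeriv_fun_sum _ fun σ _ => (hd σ).const_mul (f σ)]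
  funext G
  simp only [partialDeriv_mul (differentiable_const _) (hd _), partialDeriv_const,
    partialDeriv_gibbs, zero_mul, zero_add]
  simp only [qavg, Finset.sum_mul _ _ (∑ τ, _), Finset.mul_sum Finset.univ _ (β / Real.sqrt N),
    ← Finset.sum_sub_distrib]
  exact Finset.sum_congr rfl fun σ _ => by ring

/-- The algebra of functions of the disorder generated by constants, the disorder coordinates and
the Gibbs weights. -/
inductive GibbsPoly : (Disorder N → ℝ) → Prop
  | const (a : ℝ) : GibbsPoly fun _ => a
  | coord (p : Pairs N) : GibbsPoly fun G => G p
  | weight (σ : Config N) : GibbsPoly fun G => gibbs β h G σ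
  | add {F H : Disorder N → ℝ} : GibbsPoly F → GibbsPoly H → GibbsPoly fun G => F G + H G
  | mul {F H : Disorder N → ℝ} : GibbsPoly F → GibbsPoly H → GibbsPoly fun G => F G * H G

variable {β h}

namespace GibbsPoly

theorem sub {F H : Disorder N → ℝ} (hF : GibbsPoly β h F) (hH : GibbsPoly β h H) :
    GibbsPoly β h fun G => F G - H G := by
  have := hF.add ((const (-1)).mul hH)
  simpa [sub_eq_add_neg] using this

theorem sum {κ : Type*} (s : Finset κ) {F : κ → Disorder N → ℝ}
    (hF : ∀ k ∈ s, GibbsPoly β h (F k)) : GibbsPoly β h fun G => ∑ k ∈ s, F k G := by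
  classical
  induction s using Finset.induction_on with
  | empty => simpa using const 0
  | insert a s ha ih =>
    simp only [Finset.sum_insert ha]
    exact (hF a (Finset.mem_insert_self a s)).add
      (ih fun k hk => hF k (Finset.mem_insert_of_mem hk))

theorem pow {F : Disorder N → ℝ} (hF : GibbsPoly β h F) (n : ℕ) :
    GibbsPoly β h fun G => F G ^ n := by
  induction n with
  | zero => simpa using const 1
  | succ n ih => simpa only [pow_succ] using ih.mul hF

theorem qavg (f : Config N → ℝ) : GibbsPoly β h fun G => qavg β h G f :=
  sum _ fun σ _ => (const (f σ)).mul (weight σ)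

theorem qavg2 (f : Config N → Config N → ℝ) : GibbsPoly β h fun G => qavg2 β h G f :=
  sum _ fun σ _ => sum _ fun τ _ => ((const (f σ τ)).mul (weight σ)).mul (weight τ)

theorem contDiff {F : Disorder N → ℝ} (hF : GibbsPoly β h F) : ContDiff ℝ ⊤ F := by
  induction hF with
  | const a => exact contDiff_const
  | coord p => exact contDiff_apply ℝ ℝ p
  | weight σ => exact contDiff_gibbs β h σ
  | add _ _ h1 h2 => exact h1.add h2
  | mul _ _ h1 h2 => exact h1.mul h2

theorem differentiable {F : Disorder N → ℝ} (hF : GibbsPoly β h F) : Differentiable ℝ F :=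
  hF.contDiff.differentiable (by simp)

theorem partialDeriv {F : Disorder N → ℝ} (hF : GibbsPoly β h F) (p : Pairs N) :
    GibbsPoly β h (partialDeriv p F) := by
  induction hF with
  | const a => rw [partialDeriv_const]; exact const 0
  | coord q => rw [partialDeriv_coord]; exact const _
  | weight σ =>
    rw [partialDeriv_gibbs]
    exact (const _).mul (((const _).mul (weight σ)).sub ((weight σ).mul (qavg _)))
  | add h1 h2 i1 i2 =>
    rw [partialDeriv_add h1.differentiable h2.differentiable]
    exact i1.add i2
  | mul h1 h2 i1 i2 =>
    rw [partialDeriv_mul h1.differentiable h2.differentiable]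
    exact (i1.mul h2).add (h1.mul i2)

instance : IsProbabilityMeasure (μdis N) := by
  unfold μdis
  infer_instance

theorem memLp {F : Disorder N → ℝ} (hF : GibbsPoly β h F) (r : NNReal) :
    MemLp F r (μdis N) := by
  induction hF generalizing r with
  | const a => exact memLp_const a
  | coord p =>
    exact (memLp_id_gaussianReal (μ := 0) (v := 1) r).comp_measurePreserving
      (measurePreserving_eval (fun _ : Pairs N => gaussianReal 0 1) p)
  | weight σ =>
    refine MemLp.of_bound (contDiff_gibbs β h σ).continuous.aestronglyMeasurable 1 ?_
    exact Filter.Eventually.of_forall fun G => by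
      rw [Real.norm_of_nonneg (gibbs_nonneg β h G σ)]
      exact gibbs_le_one β h G σ
  | add _ _ h1 h2 => exact (h1 r).add (h2 r)
  | mul _ _ h1 h2 =>
    have : ENNReal.HolderTriple ((2 * r : NNReal) : ENNReal) ((2 * r : NNReal) : ENNReal) r := by
      constructor
      push_cast
      rw [ENNReal.mul_inv (by simp) (by simp), ← add_mul, ENNReal.inv_two_add_inv_two, one_mul]
    exact (h2 (2 * r)).mul (h1 (2 * r))

theorem integrable {F : Disorder N → ℝ} (hF : GibbsPoly β h F) : Integrable F (μdis N) :=
  memLp_one_iff_integrable.1 (hF.memLp 1)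

theorem integral_coord_mul {F : Disorder N → ℝ} (hF : GibbsPoly β h F) (p : Pairs N) :
    ∫ G, G p * F G ∂μdis N = ∫ G, SK.partialDeriv p F G ∂μdis N :=
  integral_coord_mul_pi_gaussianReal hF.differentiable p hF.integrable
    (hF.partialDeriv p).integrable ((coord p).mul hF).integrable

/-- Covariance of two one-coordinate Skorokhod integrals. -/
theorem integral_divergence_mul_divergence {F H : Disorder N → ℝ} (hF : GibbsPoly β h F)
    (hH : GibbsPoly β h H) (p r : Pairs N) :
    ∫ G, (G p * F G - SK.partialDeriv p F G) * (G r * H G - SK.partialDeriv r H G) ∂μdis N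
      = ∫ G, ((if p = r then F G * H G else 0)
          + SK.partialDeriv r F G * SK.partialDeriv p H G) ∂μdis N := by
  have hU : GibbsPoly β h fun G => G r * H G - SK.partialDeriv r H G :=
    ((coord r).mul hH).sub (hH.partialDeriv r)
  have hdU : SK.partialDeriv p (fun G => G r * H G - SK.partialDeriv r H G)
      = fun G => ((if p = r then 1 else 0) * H G + G r * SK.partialDeriv p H G)
          - SK.partialDeriv p (SK.partialDeriv r H) G := by
    rw [partialDeriv_sub ((coord r).mul hH).differentiable (hH.partialDeriv r).differentiable,
      partialDeriv_mul (coord (β := β) (h := h) r).differentiable hH.differentiable,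
      partialDeriv_coord]
  have h1 := (hF.mul hU).integral_coord_mul p
  rw [partialDeriv_mul hF.differentiable hU.differentiable, hdU] at h1
  have h2 := (hF.mul (hH.partialDeriv p)).integral_coord_mul r
  rw [partialDeriv_mul hF.differentiable (hH.partialDeriv p).differentiable,
    partialDeriv_comm (hH.contDiff.of_le (by simp)) r p] at h2
  have hδ : GibbsPoly β h fun G => (if p = r then F G * H G else 0) := by
    split_ifs
    exacts [hF.mul hH, const 0]
  have i1 := ((coord p).mul (hF.mul hU)).integrable
  have i2 := ((hF.partialDeriv p).mul hU).integrable
  have i3 := ((coord r).mul (hF.mul (hH.partialDeriv p))).integrable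
  have i5 := (hF.mul ((hH.partialDeriv r).partialDeriv p)).integrable
  have i6 := ((hF.partialDeriv r).mul (hH.partialDeriv p)).integrable
  have i7 := hδ.integrable
  have i8 := (hδ.add ((coord r).mul (hF.mul (hH.partialDeriv p)))).integrable
  calc _ = ∫ G, G p * (F G * (G r * H G - SK.partialDeriv r H G)) ∂μdis N
        - ∫ G, SK.partialDeriv p F G * (G r * H G - SK.partialDeriv r H G) ∂μdis N := by
        rw [← integral_sub i1 i2]
        exact integral_congr_ae (Filter.Eventually.of_forall fun G => by ring)
    _ = (∫ G, (if p = r then F G * H G else 0) ∂μdis N)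
          + (∫ G, G r * (F G * SK.partialDeriv p H G) ∂μdis N)
          - ∫ G, F G * SK.partialDeriv p (SK.partialDeriv r H) G ∂μdis N := by
        rw [h1, ← integral_add i7 i3, ← integral_sub i8 i5, ← integral_sub ?_ i2]
        · exact integral_congr_ae (Filter.Eventually.of_forall fun G => by
            beta_reduce
            split_ifs <;> ring)
        · rw [← hdU]
          exact (((hF.partialDeriv p).mul hU).add (hF.mul (hU.partialDeriv p))).integrable
    _ = _ := by
        rw [h2, integral_add i6 i5, integral_add i7 i6]
        ring

end GibbsPoly

end

section
variable {N : ℕ} (β h : ℝ) (G : Disorder N)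

theorem qavg_add (f g : Config N → ℝ) :
    qavg β h G (fun σ => f σ + g σ) = qavg β h G f + qavg β h G g := by
  simp only [qavg, add_mul, Finset.sum_add_distrib]

theorem qavg_sub (f g : Config N → ℝ) :
    qavg β h G (fun σ => f σ - g σ) = qavg β h G f - qavg β h G g := by
  simp only [qavg, sub_mul, Finset.sum_sub_distrib]

theorem qavg_const_mul (a : ℝ) (f : Config N → ℝ) :
    qavg β h G (fun σ => a * f σ) = a * qavg β h G f := by
  simp only [qavg, Finset.mul_sum, mul_assoc]

theorem qavg_const (a : ℝ) : qavg β h G (fun _ => a) = a := by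
  simp only [qavg, ← Finset.mul_sum, sum_gibbs, mul_one]

theorem qavg_sum {κ : Type*} (s : Finset κ) (f : κ → Config N → ℝ) :
    qavg β h G (fun σ => ∑ k ∈ s, f k σ) = ∑ k ∈ s, qavg β h G (f k) := by
  simp only [qavg, Finset.sum_mul]
  exact Finset.sum_comm

theorem abs_qavg_le {f : Config N → ℝ} {a : ℝ} (hf : ∀ σ, |f σ| ≤ a) : |qavg β h G f| ≤ a := by
  calc |qavg β h G f| ≤ ∑ σ, |f σ * gibbs β h G σ| := Finset.abs_sum_le_sum_abs _ _
    _ ≤ ∑ σ, a * gibbs β h G σ := Finset.sum_le_sum fun σ _ => by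
        rw [abs_mul, abs_of_nonneg (gibbs_nonneg β h G σ)]
        exact mul_le_mul_of_nonneg_right (hf σ) (gibbs_nonneg β h G σ)
    _ = a := qavg_const β h G a

theorem qavg2_mono {f g : Config N → Config N → ℝ} (hfg : ∀ σ τ, f σ τ ≤ g σ τ) :
    qavg2 β h G f ≤ qavg2 β h G g :=
  Finset.sum_le_sum fun σ _ => Finset.sum_le_sum fun τ _ =>
    mul_le_mul_of_nonneg_right (mul_le_mul_of_nonneg_right (hfg σ τ) (gibbs_nonneg β h G σ))
      (gibbs_nonneg β h G τ)

theorem qavg2_add (f g : Config N → Config N → ℝ) :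
    qavg2 β h G (fun σ τ => f σ τ + g σ τ) = qavg2 β h G f + qavg2 β h G g := by
  simp only [qavg2, add_mul, Finset.sum_add_distrib]

theorem qavg2_const_mul (a : ℝ) (f : Config N → Config N → ℝ) :
    qavg2 β h G (fun σ τ => a * f σ τ) = a * qavg2 β h G f := by
  simp only [qavg2, Finset.mul_sum, mul_assoc]

theorem qavg2_const (a : ℝ) : qavg2 β h G (fun _ _ => a) = a := by
  simp only [qavg2, mul_assoc, ← Finset.mul_sum, sum_gibbs, mul_one]

theorem qavg2_mul (f g : Config N → ℝ) :
    qavg2 β h G (fun σ τ => f σ * g τ) = qavg β h G f * qavg β h G g := by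
  simp only [qavg2, qavg, Finset.sum_mul_sum]
  exact Finset.sum_congr rfl fun σ _ => Finset.sum_congr rfl fun τ _ => by ring

theorem abs_qavg2_le (f : Config N → Config N → ℝ) :
    |qavg2 β h G f| ≤ qavg2 β h G fun σ τ => |f σ τ| := by
  refine (Finset.abs_sum_le_sum_abs _ _).trans (Finset.sum_le_sum fun σ _ => ?_)
  refine (Finset.abs_sum_le_sum_abs _ _).trans (Finset.sum_le_sum fun τ _ => ?_)
  rw [abs_mul, abs_mul, abs_of_nonneg (gibbs_nonneg β h G σ),
    abs_of_nonneg (gibbs_nonneg β h G τ)]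

theorem qavg2_sum {κ : Type*} (s : Finset κ) (f : κ → Config N → Config N → ℝ) :
    qavg2 β h G (fun σ τ => ∑ k ∈ s, f k σ τ) = ∑ k ∈ s, qavg2 β h G (f k) := by
  classical
  induction s using Finset.induction_on with
  | empty => simpa using qavg2_const β h G 0
  | insert a s ha ih => simp only [Finset.sum_insert ha, qavg2_add, ih]

theorem abs_spin (b : Bool) : |spin b| = 1 := by
  cases b <;> simp [spin]

theorem spin_mul_self (b : Bool) : spin b * spin b = 1 := by
  cases b <;> simp [spin]

theorem abs_mavg_le (i : Fin N) : |mavg β h G i| ≤ 1 :=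
  abs_qavg_le β h G fun σ => (abs_spin (σ i)).le

/-- Gibbs covariance of two observables. -/
noncomputable def gibbsCov (f g : Config N → ℝ) : ℝ :=
  qavg β h G (fun σ => f σ * g σ) - qavg β h G f * qavg β h G g

/-- Gibbs average of the distance of the overlap of two replicas to `q`. -/
noncomputable def overlapDev (q : ℝ) : ℝ :=
  qavg2 β h G fun σ τ => |overlap σ τ - q|

theorem card_mul_overlap (hN : 0 < N) (σ τ : Config N) :
    (N : ℝ) * overlap σ τ = ∑ i, spin (σ i) * spin (τ i) := by
  have : (N : ℝ) ≠ 0 := by positivity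
  rw [overlap]
  field_simp

theorem abs_overlap_le (hN : 0 < N) (σ τ : Config N) : |overlap σ τ| ≤ 1 := by
  have hN' : (0 : ℝ) < N := by exact_mod_cast hN
  refine le_of_mul_le_mul_left ?_ hN'
  rw [← abs_of_pos hN', ← abs_mul, abs_of_pos hN', card_mul_overlap hN]
  refine (Finset.abs_sum_le_sum_abs _ _).trans ?_
  simp [abs_mul, abs_spin]

/-- The squared covariances of an observable with the single spins are controlled by the
fluctuations of the overlap. -/
theorem sum_sq_gibbsCov_spin_le (hN : 0 < N) (q : ℝ) {f : Config N → ℝ} (hf : ∀ σ, |f σ| ≤ 1) :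
    ∑ j, gibbsCov β h G (fun σ => spin (σ j)) f ^ 2 ≤ N * (4 * overlapDev β h G q) := by
  set a : Config N → ℝ := fun σ => f σ - qavg β h G f with ha
  have ha0 : qavg β h G a = 0 := by
    rw [ha, qavg_sub, qavg_const, sub_self]
  have ha2 : ∀ σ, |a σ| ≤ 2 := fun σ => by
    have := abs_sub (f σ) (qavg β h G f)
    linarith [hf σ, abs_qavg_le β h G hf]
  have hc : ∀ j, gibbsCov β h G (fun σ => spin (σ j)) f
      = qavg β h G fun σ => spin (σ j) * a σ := by
    intro j
    have : (fun σ : Config N => spin (σ j) * a σ)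
        = fun σ => spin (σ j) * f σ - qavg β h G f * spin (σ j) := by
      funext σ; simp only [ha]; ring
    rw [this, qavg_sub, qavg_const_mul, gibbsCov]
    ring
  have h1 : ∑ j, gibbsCov β h G (fun σ => spin (σ j)) f ^ 2
      = N * qavg2 β h G fun σ τ => (overlap σ τ - q) * (a σ * a τ) := by
    have e1 : (fun σ τ : Config N => (overlap σ τ - q) * (a σ * a τ))
        = fun σ τ => overlap σ τ * (a σ * a τ) + (-q) * (a σ * a τ) := by
      funext σ τ; ring
    rw [e1, qavg2_add, qavg2_const_mul, qavg2_mul, ha0, mul_zero, mul_zero, add_zero,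
      ← qavg2_const_mul]
    have e2 : (fun σ τ : Config N => (N : ℝ) * (overlap σ τ * (a σ * a τ)))
        = fun σ τ => ∑ j, (spin (σ j) * a σ) * (spin (τ j) * a τ) := by
      funext σ τ
      rw [← mul_assoc, card_mul_overlap hN, Finset.sum_mul]
      exact Finset.sum_congr rfl fun j _ => by ring
    rw [e2, qavg2_sum]
    exact Finset.sum_congr rfl fun j _ => by
      rw [qavg2_mul β h G (fun σ => spin (σ j) * a σ), hc, sq]
  rw [h1]
  refine mul_le_mul_of_nonneg_left ?_ N.cast_nonneg
  refine (le_abs_self _).trans ((abs_qavg2_le β h G _).trans ?_)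
  rw [overlapDev, ← qavg2_const_mul]
  refine qavg2_mono β h G fun σ τ => ?_
  rw [abs_mul, abs_mul, mul_comm (4 : ℝ)]
  refine mul_le_mul_of_nonneg_left ?_ (abs_nonneg _)
  nlinarith [ha2 σ, ha2 τ, abs_nonneg (a σ), abs_nonneg (a τ)]

theorem overlapDev_le_two (hN : 0 < N) {q : ℝ} (h0 : 0 ≤ q) (h1 : q ≤ 1) :
    overlapDev β h G q ≤ 2 := by
  rw [← qavg2_const β h G 2]
  refine qavg2_mono β h G fun σ τ => ?_
  have := abs_overlap_le hN σ τ
  have := abs_sub (overlap σ τ) q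
  rw [abs_of_nonneg h0] at this
  linarith

theorem overlapDev_nonneg (q : ℝ) : 0 ≤ overlapDev β h G q :=
  (abs_nonneg _).trans (abs_qavg2_le β h G fun σ τ => overlap σ τ - q)

theorem overlapDev_le (q : ℝ) {ε : ℝ} (hε : 0 < ε) :
    overlapDev β h G q
      ≤ ε + (1 / ε ^ 3) * qavg2 β h G fun σ τ => (overlap σ τ - q) ^ 4 := by
  rw [← qavg2_const_mul, ← qavg2_const β h G ε, ← qavg2_add, qavg2_const]
  refine qavg2_mono β h G fun σ τ => ?_
  set x := overlap σ τ - q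
  rcases le_total |x| ε with hx | hx
  · have : 0 ≤ 1 / ε ^ 3 * x ^ 4 := by positivity
    linarith
  · have h4 : x ^ 4 = |x| ^ 3 * |x| :=
      (Even.pow_abs (by decide) x).symm.trans (pow_succ _ 3)
    have h3 : ε ^ 3 ≤ |x| ^ 3 := pow_le_pow_left₀ hε.le hx 3
    have : |x| ≤ 1 / ε ^ 3 * x ^ 4 := by
      rw [h4, one_div, inv_mul_eq_div, le_div_iff₀ (by positivity), mul_comm]
      exact mul_le_mul_of_nonneg_right h3 (abs_nonneg _)
    linarith

theorem integral_overlapDev_le (hN : 0 < N) {q K : ℝ} (hK : highTemp N β h q K) :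
    ∫ G, overlapDev β h G q ∂μdis N ≤ (1 + K) / Real.sqrt N := by
  have hs : 0 < Real.sqrt N := Real.sqrt_pos.2 (by exact_mod_cast hN)
  have i4 := (GibbsPoly.qavg2 (β := β) (h := h) (N := N)
    fun σ τ => (overlap σ τ - q) ^ 4).integrable
  calc ∫ G, overlapDev β h G q ∂μdis N
      ≤ ∫ G, (1 / Real.sqrt N + (1 / (1 / Real.sqrt N) ^ 3)
          * qavg2 β h G fun σ τ => (overlap σ τ - q) ^ 4) ∂μdis N :=
        integral_mono (GibbsPoly.qavg2 _).integrable
          ((integrable_const _).add (i4.const_mul _))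
          fun G => overlapDev_le β h G q (one_div_pos.2 hs)
    _ = 1 / Real.sqrt N + (1 / (1 / Real.sqrt N) ^ 3)
          * ∫ G, qavg2 β h G (fun σ τ => (overlap σ τ - q) ^ 4) ∂μdis N := by
        rw [integral_add (integrable_const _) (i4.const_mul _), integral_const_mul]
        simp
    _ ≤ 1 / Real.sqrt N + (1 / (1 / Real.sqrt N) ^ 3) * (K / (N : ℝ) ^ 2) := by
        gcongr
        exact hK
    _ = (1 + K) / Real.sqrt N := by
        have e : (N : ℝ) = Real.sqrt N ^ 2 := (Real.sq_sqrt N.cast_nonneg).symm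
        have e2 : (N : ℝ) ^ 2 = Real.sqrt N ^ 4 := by
          nth_rewrite 1 [e]; ring
        rw [e2]
        field_simp

end

section
variable {N : ℕ} (β h : ℝ) (G : Disorder N) (z : Fin N)

/-- The pair `(z, j)` with `z < j`. -/
def edge (j : {j : Fin N // z < j}) : Pairs N := ⟨(z, j), j.2⟩

theorem edge_inj {j k : {j : Fin N // z < j}} : edge z j = edge z k ↔ j = k := by
  simp [edge, Subtype.ext_iff]

/-- Gibbs covariance of the spins at `j` and `z`. -/
noncomputable def spinCov (j : Fin N) : ℝ :=
  gibbsCov β h G (fun σ => spin (σ j)) (fun σ => spin (σ z))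

/-- The derivative of `spinCov` with respect to `g_{zk}`, up to the factor `β / √N`. -/
noncomputable def spinCovDeriv (j k : Fin N) : ℝ :=
  gibbsCov β h G (fun σ => spin (σ j)) (fun σ => spin (σ k))
    - spinCov β h G z j * qavg β h G (fun σ => spin (σ z) * spin (σ k))
    - mavg β h G z * gibbsCov β h G (fun σ => spin (σ j)) (fun σ => spin (σ z) * spin (σ k))

theorem GibbsPoly.spinCov (j : Fin N) : GibbsPoly β h fun G => spinCov β h G z j :=
  (GibbsPoly.qavg _).sub ((GibbsPoly.qavg _).mul (GibbsPoly.qavg _))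

theorem GibbsPoly.overlapDev (q : ℝ) : GibbsPoly β h fun G : Disorder N => overlapDev β h G q :=
  GibbsPoly.qavg2 _

theorem partialDeriv_spinCov (j : Fin N) (k : {k : Fin N // z < k}) :
    partialDeriv (edge z k) (fun G => spinCov β h G z j)
      = fun G => (β / Real.sqrt N) * spinCovDeriv β h G z j k := by
  have e : (fun G => spinCov β h G z j) = fun G =>
      qavg β h G (fun σ => spin (σ j) * spin (σ z))
        - qavg β h G (fun σ => spin (σ j)) * qavg β h G (fun σ => spin (σ z)) := rfl
  have d : ∀ f, Differentiable ℝ (fun G : Disorder N => qavg β h G f) :=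
    fun f => (GibbsPoly.qavg (β := β) (h := h) f).differentiable
  rw [e, partialDeriv_sub (d _) ((d _).fun_mul (d _)), partialDeriv_mul (d _) (d _)]
  simp only [partialDeriv_qavg]
  funext G
  have e1 : (fun σ : Config N => spin (σ j) * spin (σ z) * pairSpin (edge z k) σ)
      = fun σ => spin (σ j) * spin (σ k) := by
    funext σ
    simp only [pairSpin, edge]
    linear_combination spin (σ j) * spin (σ k) * spin_mul_self (σ z)
  have e2 : (fun σ : Config N => spin (σ z) * pairSpin (edge z k) σ)
      = fun σ => spin (σ k) := by
    funext σ
    simp only [pairSpin, edge]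
    linear_combination spin (σ k) * spin_mul_self (σ z)
  have e3 : pairSpin (edge z k) = fun σ : Config N => spin (σ z) * spin (σ k) := rfl
  rw [e1, e2, e3]
  simp only [spinCovDeriv, spinCov, gibbsCov, mavg]
  ring

theorem qavg_spin_mul_self (i : Fin N) : qavg β h G (fun σ => spin (σ i) * spin (σ i)) = 1 := by
  simp only [spin_mul_self, qavg_const]

theorem spinCovDeriv_self (j : Fin N) :
    spinCovDeriv β h G z j j
      = (1 - mavg β h G z ^ 2) * (1 - mavg β h G j ^ 2) - spinCov β h G z j ^ 2 := by
  have e1 : (fun σ : Config N => spin (σ j) * (spin (σ z) * spin (σ j)))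
      = fun σ => spin (σ z) := by
    funext σ
    linear_combination spin (σ z) * spin_mul_self (σ j)
  have e2 : (fun σ : Config N => spin (σ z) * spin (σ j))
      = fun σ => spin (σ j) * spin (σ z) := by
    funext σ
    ring
  simp only [spinCovDeriv, spinCov, gibbsCov, mavg, qavg_spin_mul_self, e1]
  rw [e2]
  ring

theorem abs_spin_mul_spin_le (i j : Fin N) (σ : Config N) : |spin (σ i) * spin (σ j)| ≤ 1 := by
  rw [abs_mul, abs_spin, abs_spin, one_mul]

theorem sq_spinCovDeriv_le (j k : Fin N) :
    spinCovDeriv β h G z j k ^ 2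
      ≤ 3 * (gibbsCov β h G (fun σ => spin (σ j)) (fun σ => spin (σ k)) ^ 2
        + spinCov β h G z j ^ 2
        + gibbsCov β h G (fun σ => spin (σ j)) (fun σ => spin (σ z) * spin (σ k)) ^ 2) := by
  rw [spinCovDeriv]
  set a := gibbsCov β h G (fun σ => spin (σ j)) (fun σ => spin (σ k))
  set b := spinCov β h G z j
  set c := gibbsCov β h G (fun σ => spin (σ j)) (fun σ => spin (σ z) * spin (σ k))
  have hw := (sq_le_one_iff_abs_le_one _).2 (abs_qavg_le β h G (abs_spin_mul_spin_le z k))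
  have hm := (sq_le_one_iff_abs_le_one _).2 (abs_mavg_le β h G z)
  set w := qavg β h G (fun σ => spin (σ z) * spin (σ k))
  set m := mavg β h G z
  have h1 : (b * w) ^ 2 ≤ b ^ 2 := by
    rw [mul_pow]; exact mul_le_of_le_one_right (sq_nonneg b) hw
  have h2 : (m * c) ^ 2 ≤ c ^ 2 := by
    rw [mul_pow]; exact mul_le_of_le_one_left (sq_nonneg c) hm
  nlinarith [sq_nonneg (a + b * w), sq_nonneg (a + m * c), sq_nonneg (b * w - m * c)]

theorem sum_gt_le_sum {f : Fin N → ℝ} (hf : ∀ j, 0 ≤ f j) :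
    ∑ j : {j : Fin N // z < j}, f j ≤ ∑ j, f j := by
  rw [← Finset.sum_subtype (Finset.univ.filter fun j => z < j) (by simp) f]
  exact Finset.sum_le_sum_of_subset_of_nonneg (Finset.filter_subset _ _) fun j _ _ => hf j

theorem sum_sq_spinCov_le (hN : 0 < N) (q : ℝ) :
    ∑ j : {j : Fin N // z < j}, spinCov β h G z j ^ 2 ≤ N * (4 * overlapDev β h G q) :=
  (sum_gt_le_sum z fun j => sq_nonneg (spinCov β h G z j)).trans
    (sum_sq_gibbsCov_spin_le β h G hN q fun σ => (abs_spin (σ z)).le)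

theorem sum_sq_spinCovDeriv_le (hN : 0 < N) (q : ℝ) (k : Fin N) :
    ∑ j, spinCovDeriv β h G z j k ^ 2 ≤ N * (36 * overlapDev β h G q) := by
  refine (Finset.sum_le_sum fun j _ => sq_spinCovDeriv_le β h G z j k).trans ?_
  rw [← Finset.mul_sum, Finset.sum_add_distrib, Finset.sum_add_distrib]
  have h1 := sum_sq_gibbsCov_spin_le β h G hN q fun σ => (abs_spin (σ k)).le
  have h2 := sum_sq_gibbsCov_spin_le β h G hN q fun σ => (abs_spin (σ z)).le
  have h3 := sum_sq_gibbsCov_spin_le β h G hN q (abs_spin_mul_spin_le z k)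
  simp only [spinCov]
  linarith

theorem sum_spinCovDeriv_mul_le (hN : 0 < N) (q : ℝ) :
    ∑ j : {j : Fin N // z < j}, ∑ k : {k : Fin N // z < k},
        spinCovDeriv β h G z j k * spinCovDeriv β h G z k j
      ≤ N * (N * (36 * overlapDev β h G q)) := by
  set T := spinCovDeriv β h G z
  have hsym : ∑ j : {j : Fin N // z < j}, ∑ k : {k : Fin N // z < k}, T k j ^ 2
      = ∑ j : {j : Fin N // z < j}, ∑ k : {k : Fin N // z < k}, T j k ^ 2 :=
    Finset.sum_comm
  have hle : ∑ j : {j : Fin N // z < j}, ∑ k : {k : Fin N // z < k}, T k j ^ 2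
      ≤ N * (N * (36 * overlapDev β h G q)) := by
    calc _ ≤ ∑ j : {j : Fin N // z < j}, ∑ k, T k j ^ 2 :=
          Finset.sum_le_sum fun j _ =>
            sum_gt_le_sum z (f := fun k => T k j ^ 2) fun k => sq_nonneg _
      _ ≤ ∑ j : Fin N, ∑ k, T k j ^ 2 :=
          sum_gt_le_sum z (f := fun j => ∑ k, T k j ^ 2) fun j =>
            Finset.sum_nonneg fun k _ => sq_nonneg _
      _ ≤ ∑ _j : Fin N, N * (36 * overlapDev β h G q) :=
          Finset.sum_le_sum fun j _ => sum_sq_spinCovDeriv_le β h G z hN q j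
      _ = _ := by simp
  calc _ ≤ ∑ j : {j : Fin N // z < j}, ∑ k : {k : Fin N // z < k},
        (T j k ^ 2 / 2 + T k j ^ 2 / 2) :=
        Finset.sum_le_sum fun j _ => Finset.sum_le_sum fun k _ => by
          nlinarith [sq_nonneg (T j k - T k j)]
    _ ≤ _ := by
        simp only [Finset.sum_add_distrib, ← Finset.sum_div]
        linarith

/-- The divergence of the vector field `j ↦ spinCov z j` in the variables `g_{zj}`. -/
noncomputable def spinDivergence : ℝ :=
  ∑ j : {j : Fin N // z < j}, (G (edge z j) * spinCov β h G z j
    - partialDeriv (edge z j) (fun G => spinCov β h G z j) G)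

theorem GibbsPoly.spinDivergence : GibbsPoly β h fun G => spinDivergence β h G z :=
  GibbsPoly.sum _ fun j _ => ((GibbsPoly.coord _).mul (GibbsPoly.spinCov β h z j)).sub
    ((GibbsPoly.spinCov β h z j).partialDeriv _)

theorem integral_sq_spinDivergence_le (hN : 0 < N) (q : ℝ) :
    ∫ G, spinDivergence β h G z ^ 2 ∂μdis N
      ≤ N * (4 + 36 * β ^ 2) * ∫ G, overlapDev β h G q ∂μdis N := by
  have hc := fun j : {j : Fin N // z < j} => GibbsPoly.spinCov β h z j
  have hU := fun j : {j : Fin N // z < j} =>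
    ((GibbsPoly.coord (edge z j)).mul (hc j)).sub ((hc j).partialDeriv (edge z j))
  have hW : ∀ j k : {j : Fin N // z < j}, GibbsPoly β h fun G =>
      (if edge z j = edge z k then spinCov β h G z j * spinCov β h G z k else 0)
        + partialDeriv (edge z k) (fun G => spinCov β h G z j) G
          * partialDeriv (edge z j) (fun G => spinCov β h G z k) G := by
    intro j k
    refine GibbsPoly.add ?_ (((hc j).partialDeriv _).mul ((hc k).partialDeriv _))
    split_ifs
    exacts [(hc j).mul (hc k), GibbsPoly.const 0]
  have hsN : Real.sqrt N ^ 2 = N := Real.sq_sqrt N.cast_nonneg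
  have hN' : (N : ℝ) ≠ 0 := by positivity
  simp only [spinDivergence, sq, Finset.sum_mul_sum]
  rw [integral_finsetSum _ fun j _ => (GibbsPoly.sum _ fun k _ =>
    (hU j).mul (hU k)).integrable]
  simp only [integral_finsetSum Finset.univ fun k _ => ((hU _).mul (hU k)).integrable,
    GibbsPoly.integral_divergence_mul_divergence (hc _) (hc _)]
  simp only [← integral_finsetSum Finset.univ fun k _ => (hW _ k).integrable]
  rw [← integral_finsetSum Finset.univ fun j _ =>
    (GibbsPoly.sum _ fun k _ => hW j k).integrable, ← integral_const_mul]
  refine integral_mono (GibbsPoly.sum _ fun j _ => GibbsPoly.sum _ fun k _ => hW j k).integrable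
    ((GibbsPoly.overlapDev β h q).integrable.const_mul _) fun G => ?_
  simp only [edge_inj, partialDeriv_spinCov, Finset.sum_add_distrib, Finset.sum_ite_eq,
    Finset.mem_univ, if_true, ← sq]
  have e : ∀ j k : {j : Fin N // z < j},
      β / Real.sqrt N * spinCovDeriv β h G z j k * (β / Real.sqrt N * spinCovDeriv β h G z k j)
        = β ^ 2 / N * (spinCovDeriv β h G z j k * spinCovDeriv β h G z k j) := by
    intro j k
    have : β ^ 2 / N = (β / Real.sqrt N) ^ 2 := by rw [div_pow, hsN]
    rw [this]
    ring
  simp only [e, ← Finset.mul_sum]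
  have h1 := sum_sq_spinCov_le β h G z hN q
  have h2 := mul_le_mul_of_nonneg_left (sum_spinCovDeriv_mul_le β h G z hN q)
    (by positivity : 0 ≤ β ^ 2 / N)
  have h3 : β ^ 2 / N * (N * (N * (36 * overlapDev β h G q)))
      = N * (36 * β ^ 2) * overlapDev β h G q := by
    field_simp
  linarith

theorem sum_sq_mavg (hN : 0 < N) :
    ∑ j, mavg β h G j ^ 2 = N * qavg2 β h G overlap := by
  rw [← qavg2_const_mul]
  simp only [card_mul_overlap hN, qavg2_sum, qavg2_mul β h G (fun σ => spin (σ _))]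
  exact Finset.sum_congr rfl fun j _ => sq _

theorem abs_qavg2_overlap_sub_le (q : ℝ) :
    |qavg2 β h G overlap - q| ≤ overlapDev β h G q := by
  have : qavg2 β h G overlap - q = qavg2 β h G fun σ τ => overlap σ τ - q := by
    have := qavg2_add β h G overlap fun _ _ => -q
    rw [qavg2_const] at this
    simpa only [sub_eq_add_neg] using this.symm
  rw [this]
  exact abs_qavg2_le β h G _

theorem sum_gt_eq_sum_erase (hz : ∀ j, z ≤ j) (f : Fin N → ℝ) :
    ∑ j : {j : Fin N // z < j}, f j = ∑ j ∈ Finset.univ.erase z, f j :=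
  (Finset.sum_subtype _ (fun j => by
    rw [Finset.mem_erase]
    exact ⟨fun hj => lt_of_le_of_ne (hz j) hj.1.symm,
      fun hj => ⟨hj.ne', Finset.mem_univ j⟩⟩) f).symm

theorem abs_sum_spinCovDeriv_sub_le (hN : 0 < N) (hz : ∀ j, z ≤ j) (q : ℝ) :
    |1 / N * ∑ j : {j : Fin N // z < j}, spinCovDeriv β h G z j j
        - (1 - q) * (1 - mavg β h G z ^ 2)| ≤ 5 * overlapDev β h G q + 1 / N := by
  have hN' : (0 : ℝ) < N := by exact_mod_cast hN
  have hS : ∑ j : {j : Fin N // z < j}, (1 - mavg β h G j ^ 2)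
      = N - N * qavg2 β h G overlap - (1 - mavg β h G z ^ 2) := by
    rw [sum_gt_eq_sum_erase z hz fun j => 1 - mavg β h G j ^ 2,
      Finset.sum_erase_eq_sub (Finset.mem_univ z), Finset.sum_sub_distrib, sum_sq_mavg β h G hN]
    simp
  simp only [spinCovDeriv_self, Finset.sum_sub_distrib, ← Finset.mul_sum] at hS ⊢
  rw [hS]
  have hc := sum_sq_spinCov_le β h G z hN q
  have hc0 : 0 ≤ ∑ j : {j : Fin N // z < j}, spinCov β h G z j ^ 2 :=
    Finset.sum_nonneg fun j _ => sq_nonneg _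
  have hm := (sq_le_one_iff_abs_le_one _).2 (abs_mavg_le β h G z)
  have hm0 := sq_nonneg (mavg β h G z)
  have hr := abs_qavg2_overlap_sub_le β h G q
  set c := ∑ j : {j : Fin N // z < j}, spinCov β h G z j ^ 2
  set v := mavg β h G z ^ 2
  set R := qavg2 β h G overlap
  set r := overlapDev β h G q
  have e : 1 / N * ((1 - v) * (N - N * R - (1 - v)) - c) - (1 - q) * (1 - v)
      = (1 - v) * (q - R) - (1 - v) ^ 2 / N - c / N := by
    field_simp
    ring
  rw [e]
  have hc' : c / N ≤ 4 * r := by rwa [div_le_iff₀' hN']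
  have hc0' : 0 ≤ c / N := by positivity
  have hv : (1 - v) ^ 2 / N ≤ 1 / N := by
    gcongr
    nlinarith
  have hv0 : 0 ≤ (1 - v) ^ 2 / N := by positivity
  have hRr : |(1 - v) * (q - R)| ≤ r := by
    rw [abs_mul, abs_of_nonneg (by linarith), abs_sub_comm]
    nlinarith [abs_nonneg (R - q)]
  have hr0 : 0 ≤ r := overlapDev_nonneg β h G q
  rw [abs_le] at hRr ⊢
  constructor <;> linarith [hRr.1, hRr.2]

theorem gval_edge (j : {j : Fin N // z < j}) : gval G z j = G (edge z j) := by
  simp [gval, edge, j.2]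

theorem qavg_eta_sub_one (hz : ∀ j, z ≤ j) (q : ℝ) :
    qavg β h G (fun σ =>
        1 + β * ((1 / Real.sqrt N) * ∑ j ∈ Finset.univ.erase z,
              gval G z j * (spin (σ j) - mavg β h G j)) * spin (σ z)
          - β ^ 2 * (1 - q) * (spin (σ z) - mavg β h G z) * spin (σ z)) - 1
      = β * ((1 / Real.sqrt N) * spinDivergence β h G z
          + β * (1 / N * ∑ j : {j : Fin N // z < j}, spinCovDeriv β h G z j j
            - (1 - q) * (1 - mavg β h G z ^ 2))) := by
  have hcov : ∀ i, qavg β h G (fun σ => (spin (σ i) - mavg β h G i) * spin (σ z))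
      = spinCov β h G z i := by
    intro i
    have : (fun σ : Config N => (spin (σ i) - mavg β h G i) * spin (σ z))
        = fun σ => spin (σ i) * spin (σ z) - mavg β h G i * spin (σ z) := by
      funext σ; ring
    rw [this, qavg_sub, qavg_const_mul]
    rfl
  have hz' : spinCov β h G z z = 1 - mavg β h G z ^ 2 := by
    rw [spinCov, gibbsCov, qavg_spin_mul_self, sq]
    rfl
  have e : (fun σ : Config N =>
        1 + β * ((1 / Real.sqrt N) * ∑ j ∈ Finset.univ.erase z,
              gval G z j * (spin (σ j) - mavg β h G j)) * spin (σ z)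
          - β ^ 2 * (1 - q) * (spin (σ z) - mavg β h G z) * spin (σ z))
      = fun σ => (1 + (β * (1 / Real.sqrt N)) * ∑ j ∈ Finset.univ.erase z,
              gval G z j * ((spin (σ j) - mavg β h G j) * spin (σ z)))
          - β ^ 2 * (1 - q) * ((spin (σ z) - mavg β h G z) * spin (σ z)) := by
    funext σ
    simp only [← mul_assoc, ← Finset.sum_mul]
  rw [e, qavg_sub, qavg_add, qavg_const, qavg_const_mul, qavg_const_mul, qavg_sum]
  simp only [qavg_const_mul, hcov, hz']
  rw [← sum_gt_eq_sum_erase z hz fun j => gval G z j * spinCov β h G z j]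
  simp only [spinDivergence, gval_edge, partialDeriv_spinCov, Finset.sum_sub_distrib,
    ← Finset.mul_sum]
  have hs : 1 / (N : ℝ) = 1 / Real.sqrt N * (1 / Real.sqrt N) := by
    rw [one_div_mul_one_div, Real.mul_self_sqrt N.cast_nonneg]
  rw [hs]
  ring

end

/-- Estimate (3.16)/(4.4): `⟨η₁⟩ ≈ 1`, where
`η₁ = 1 + β ℓ̇₁ σ₁ - β²(1-q) σ̇₁ σ₁`. -/
theorem eta_one_close_to_one (β h K : ℝ) (hβ : 0 < β) (hK : 0 < K) :
    ∃ C : ℝ, 0 < C ∧ ∀ (N : ℕ) (hN : 2 ≤ N) (q : ℝ), 0 ≤ q → q < 1 →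
      highTemp N β h q K →
        ∫ G, (qavg β h G (fun σ =>
            1 + β * ((1 / Real.sqrt N)
                * ∑ j ∈ Finset.univ.erase (⟨0, by omega⟩ : Fin N),
                  gval G (⟨0, by omega⟩ : Fin N) j * (spin (σ j) - mavg β h G j))
                * spin (σ (⟨0, by omega⟩ : Fin N))
              - β ^ 2 * (1 - q)
                * (spin (σ (⟨0, by omega⟩ : Fin N))
                    - mavg β h G (⟨0, by omega⟩ : Fin N))
                * spin (σ (⟨0, by omega⟩ : Fin N)))
          - 1) ^ 2 ∂(μdis N)
        ≤ C / Real.sqrt N := by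
  refine ⟨2 * β ^ 2 * ((4 + 36 * β ^ 2) * (1 + K) + β ^ 2 * (100 * (1 + K) + 2)),
    by positivity, fun N hN q hq0 hq1 hHT => ?_⟩
  have hN0 : 0 < N := by omega
  have hz : ∀ j, (⟨0, hN0⟩ : Fin N) ≤ j := fun j => Fin.le_def.2 (Nat.zero_le _)
  simp only [qavg_eta_sub_one β h _ _ hz q]
  have hs1 : 1 ≤ Real.sqrt N := Real.one_le_sqrt.2 (by exact_mod_cast hN0)
  have hsN : (N : ℝ) = Real.sqrt N ^ 2 := (Real.sq_sqrt N.cast_nonneg).symm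
  have iV := ((GibbsPoly.spinDivergence β h (⟨0, hN0⟩ : Fin N)).pow 2).integrable
  have iR := (GibbsPoly.overlapDev (N := N) β h q).integrable
  have hV := integral_sq_spinDivergence_le β h (⟨0, hN0⟩ : Fin N) hN0 q
  have hR := integral_overlapDev_le β h hN0 hHT
  have hbound : ∀ G : Disorder N,
      (β * ((1 / Real.sqrt N) * spinDivergence β h G ⟨0, hN0⟩
          + β * (1 / N * ∑ j : {j : Fin N // ⟨0, hN0⟩ < j}, spinCovDeriv β h G ⟨0, hN0⟩ j j
            - (1 - q) * (1 - mavg β h G ⟨0, hN0⟩ ^ 2)))) ^ 2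
        ≤ 2 * β ^ 2 / N * spinDivergence β h G ⟨0, hN0⟩ ^ 2
          + (2 * β ^ 4 * 100 * overlapDev β h G q + 2 * β ^ 4 * (2 / Real.sqrt N)) := by
    intro G
    have hA := abs_sum_spinCovDeriv_sub_le β h G ⟨0, hN0⟩ hN0 hz q
    have hr0 := overlapDev_nonneg β h G q
    have hr2 := overlapDev_le_two β h G hN0 hq0 hq1.le
    set V := spinDivergence β h G ⟨0, hN0⟩
    set A := 1 / N * ∑ j : {j : Fin N // ⟨0, hN0⟩ < j}, spinCovDeriv β h G ⟨0, hN0⟩ j j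
            - (1 - q) * (1 - mavg β h G ⟨0, hN0⟩ ^ 2)
    set r := overlapDev β h G q
    have hn0 : 0 ≤ 1 / (N : ℝ) := by positivity
    have hn1 : 1 / (N : ℝ) ≤ 1 / Real.sqrt N :=
      one_div_le_one_div_of_le (by positivity) (by
        rw [hsN, Real.sqrt_sq (by positivity)]
        nlinarith)
    have hn2 : 1 / (N : ℝ) ≤ 1 :=
      (div_le_one (by positivity)).2 (by exact_mod_cast hN0)
    have hA2 : A ^ 2 ≤ 100 * r + 2 / Real.sqrt N := by
      have h1 : A ^ 2 ≤ (5 * r + 1 / N) ^ 2 := by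
        rw [← sq_abs A]
        exact pow_le_pow_left₀ (abs_nonneg A) hA 2
      have h2 : 2 / Real.sqrt N = 2 * (1 / Real.sqrt N) := by ring
      rw [h2]
      nlinarith [sq_nonneg (5 * r - 1 / N)]
    have hV2 : (1 / Real.sqrt N * V) ^ 2 = 1 / N * V ^ 2 := by
      rw [mul_pow, div_pow, one_pow, ← hsN]
    have h3 : (β * (1 / Real.sqrt N * V + β * A)) ^ 2
        ≤ 2 * β ^ 2 * ((1 / Real.sqrt N * V) ^ 2 + β ^ 2 * A ^ 2) := by
      nlinarith [mul_nonneg (sq_nonneg β) (sq_nonneg (1 / Real.sqrt N * V - β * A))]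
    refine h3.trans ?_
    rw [hV2]
    have h4 := mul_le_mul_of_nonneg_left hA2 (by positivity : 0 ≤ 2 * β ^ 4)
    have h5 : 2 * β ^ 2 * (1 / N * V ^ 2 + β ^ 2 * A ^ 2)
        = 2 * β ^ 2 / N * V ^ 2 + 2 * β ^ 4 * A ^ 2 := by ring
    rw [h5]
    linarith
  have i1 := iV.const_mul (2 * β ^ 2 / N)
  have i2 := iR.const_mul (2 * β ^ 4 * 100)
  have i3 : Integrable (fun _ : Disorder N => 2 * β ^ 4 * (2 / Real.sqrt N)) (μdis N) :=
    integrable_const _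
  have i23 : Integrable (fun G : Disorder N => 2 * β ^ 4 * 100 * overlapDev β h G q
      + 2 * β ^ 4 * (2 / Real.sqrt N)) (μdis N) := i2.add i3
  refine (integral_mono_of_nonneg (Filter.Eventually.of_forall fun G => sq_nonneg _)
    (i1.add i23) (Filter.Eventually.of_forall hbound)).trans ?_
  rw [integral_add' i1 i23, integral_add i2 i3, integral_const_mul, integral_const_mul]
  have hconst : ∫ _ : Disorder N, 2 * β ^ 4 * (2 / Real.sqrt N) ∂μdis N
      = 2 * β ^ 4 * (2 / Real.sqrt N) := by simp
  rw [hconst]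
  calc _ ≤ 2 * β ^ 2 / N * (N * (4 + 36 * β ^ 2) * ((1 + K) / Real.sqrt N))
        + (2 * β ^ 4 * 100 * ((1 + K) / Real.sqrt N) + 2 * β ^ 4 * (2 / Real.sqrt N)) := by
        gcongr
        refine hV.trans ?_
        gcongr
    _ = _ := by
        have : (N : ℝ) ≠ 0 := by positivity
        have : Real.sqrt N ≠ 0 := by positivity
        field_simp

end SK
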